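/- There exist constants C > 0 and ε₁ > 0 such that for all ε ∈ (0, ε₁), |ε⁶ ∫_{−∞}^{∞} a(τ)⁷ b(τ) sin(ψ_ε(τ)) dτ − (2/15) √(π/2) ε^{−3/2} e^{−1/(3ε³)}| ≤ C e^{−1/(3ε³)}. -/

import Mathlib

open MeasureTheory

/-- `a(τ) = 2√2/(e^τ + e^{−τ})`. -/
noncomputable def aa (τ : ℝ) : ℝ := 2 * Real.sqrt 2 / (Real.exp τ + Real.exp (-τ))

/-- `b(τ) = 2√2 (e^{−τ} − e^τ)/(e^τ + e^{−τ})²`. -/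
noncomputable def bb (τ : ℝ) : ℝ :=
  2 * Real.sqrt 2 * (Real.exp (-τ) - Real.exp τ) / (Real.exp τ + Real.exp (-τ)) ^ 2

/-- `ψ_ε(τ)`. -/
noncomputable def psi (ε τ : ℝ) : ℝ :=
  2 * Real.arctan ((Real.exp τ - Real.exp (-τ)) / 2)
    - (1 / (48 * ε ^ 3)) * (Real.exp (3 * τ) - Real.exp (-(3 * τ)))
    - (3 / (16 * ε ^ 3)) * (Real.exp τ - Real.exp (-τ))

open Complex Filter Topology

theorem integral_eq_integral_add_mul_I_of_differentiableOn_strip {f : ℂ → ℂ} {c K : ℝ}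
    (hc : 0 ≤ c) (hf : ∀ z : ℂ, 0 ≤ z.im → z.im ≤ c → DifferentiableAt ℂ f z)
    (hK : ∀ x y : ℝ, 0 ≤ y → y ≤ c → ‖f (x + y * I)‖ ≤ K * (1 + x ^ 2)⁻¹) :
    Integrable (fun x : ℝ => f x) ∧ ∫ x : ℝ, f x = ∫ x : ℝ, f (x + c * I) := by
  have hinteg : ∀ y : ℝ, 0 ≤ y → y ≤ c → Integrable (fun x : ℝ => f (x + y * I)) := by
    intro y hy hyc
    refine (integrable_inv_one_add_sq.const_mul K).mono' ?_ (.of_forall fun x => hK x y hy hyc)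
    refine Continuous.aestronglyMeasurable (continuous_iff_continuousAt.2 fun x => ?_)
    have h := (hf (x + y * I) (by simpa) (by simpa)).continuousAt
    exact ContinuousAt.comp (f := fun x : ℝ => (x + y * I : ℂ)) h (by fun_prop)
  have h0 := hinteg 0 le_rfl hc
  simp only [ofReal_zero, zero_mul, add_zero] at h0
  refine ⟨h0, ?_⟩
  have hrect : ∀ T : ℝ, (∫ x in (-T)..T, f x) - (∫ x in (-T)..T, f (x + c * I)) =
      I * (∫ y in (0 : ℝ)..c, f ((-T : ℝ) + y * I)) - I * ∫ y in (0 : ℝ)..c, f (T + y * I) := by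
    intro T
    have h := integral_boundary_rect_eq_zero_of_differentiableOn f (-T : ℝ) (T + c * I) (by
      intro z hz
      rw [mem_reProdIm] at hz
      have := hz.2
      simp only [ofReal_im, add_im, mul_im, ofReal_re, I_im, I_re, mul_one, mul_zero, add_zero,
        zero_add, Set.uIcc_of_le hc] at this
      exact (hf z this.1 this.2).differentiableWithinAt)
    simp only [ofReal_im, ofReal_re, add_im, add_re, mul_im, mul_re, I_im, I_re, mul_one, mul_zero,
      add_zero, zero_add, sub_zero, ofReal_zero, zero_mul, smul_eq_mul] at h
    linear_combination h
  have hside : ∀ T : ℝ, ‖∫ y in (0 : ℝ)..c, f (T + y * I)‖ ≤ K * (1 + T ^ 2)⁻¹ * c := by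
    intro T
    have := intervalIntegral.norm_integral_le_of_norm_le_const (a := 0) (b := c)
      (f := fun y : ℝ => f (T + y * I)) (C := K * (1 + T ^ 2)⁻¹) (by
        intro y hy
        rw [Set.uIoc_of_le hc] at hy
        exact hK T y hy.1.le hy.2)
    simpa [abs_of_nonneg hc] using this
  have hdecay : Tendsto (fun T : ℝ => K * (1 + T ^ 2)⁻¹ * c) atTop (𝓝 0) := by
    have : Tendsto (fun T : ℝ => (1 + T ^ 2)⁻¹) atTop (𝓝 0) :=
      tendsto_inv_atTop_zero.comp
        (tendsto_atTop_add_const_left _ _ (tendsto_pow_atTop two_ne_zero))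
    simpa using (this.const_mul K).mul_const c
  have hright : Tendsto (fun T : ℝ => ∫ y in (0 : ℝ)..c, f (T + y * I)) atTop (𝓝 0) :=
    squeeze_zero_norm hside hdecay
  have hleft : Tendsto (fun T : ℝ => ∫ y in (0 : ℝ)..c, f ((-T : ℝ) + y * I)) atTop (𝓝 0) :=
    squeeze_zero_norm (fun T => by simpa using hside (-T)) hdecay
  have hlim := (intervalIntegral_tendsto_integral h0 tendsto_neg_atTop_atBot tendsto_id).sub
    (intervalIntegral_tendsto_integral (hinteg c hc le_rfl) tendsto_neg_atTop_atBot tendsto_id)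
  have hlim' := (hleft.const_mul I).sub (hright.const_mul I)
  simp only [id, hrect, mul_zero, sub_zero] at hlim hlim'
  exact sub_eq_zero.1 (tendsto_nhds_unique hlim hlim')

theorem norm_exp_sub_one_le_norm_mul_exp {z : ℂ} {M : ℝ} (hM : 0 ≤ M) (hz : z.re ≤ M) :
    ‖exp z - 1‖ ≤ ‖z‖ * Real.exp M := by
  have h := (convex_halfSpace_re_le M).norm_image_sub_le_of_norm_hasDerivWithin_le
    (f := exp) (f' := exp) (x := 0) (y := z) (C := Real.exp M)
    (fun x _ => (hasDerivAt_exp x).hasDerivWithinAt)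
    (fun x hx => by rw [norm_exp]; exact Real.exp_le_exp.2 hx) (by simpa) hz
  simpa [mul_comm] using h

theorem one_le_norm_ofReal_sub_I (u : ℝ) : 1 ≤ ‖(u - I : ℂ)‖ := by
  simpa using abs_im_le_norm (u - I : ℂ)

theorem ofReal_sub_I_ne_zero (u : ℝ) : (u - I : ℂ) ≠ 0 :=
  norm_pos_iff.1 (one_pos.trans_le (one_le_norm_ofReal_sub_I u))

theorem integral_exp_neg_sq_sub_I : ∫ u : ℝ, cexp (-(u - I) ^ 2 / 2) = √(2 * Real.pi) := by
  have h := GaussianFourier.integral_cexp_neg_mul_sq_add_real_mul_I (b := 1 / 2) (by norm_num) (-1)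
  have e : (Real.pi / (1 / 2) : ℂ) = ((2 * Real.pi : ℝ) : ℂ) := by push_cast; ring
  rw [Real.sqrt_eq_rpow, ofReal_cpow (by positivity)]
  rw [e] at h
  push_cast at h ⊢
  rw [← h]
  congr 1 with u
  congr 1
  ring

theorem integrable_inv_pow_mul_exp_neg_sq_sub_I (k : ℕ) :
    Integrable fun u : ℝ => ((u - I : ℂ) ^ k)⁻¹ * cexp (-(u - I) ^ 2 / 2) := by
  have h := GaussianFourier.integrable_cexp_neg_mul_sq_add_real_mul_I (b := 1 / 2)
    (by norm_num) (-1)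
  refine Integrable.bdd_mul (c := 1) (h.congr (.of_forall fun u => ?_)) ?_ (.of_forall fun u => ?_)
  · simp only
    push_cast
    congr 1
    ring
  · refine Continuous.aestronglyMeasurable (Continuous.inv₀ (by fun_prop) fun u => ?_)
    exact pow_ne_zero _ (ofReal_sub_I_ne_zero u)
  · rw [norm_inv, norm_pow]
    exact inv_le_one_of_one_le₀ (one_le_pow₀ (one_le_norm_ofReal_sub_I u))

theorem integral_inv_pow_mul_exp_neg_sq_sub_I_succ (k : ℕ) :
    (k + 1) * ∫ u : ℝ, ((u - I : ℂ) ^ (k + 2))⁻¹ * cexp (-(u - I) ^ 2 / 2) =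
      -∫ u : ℝ, ((u - I : ℂ) ^ k)⁻¹ * cexp (-(u - I) ^ 2 / 2) := by
  have h2 := (integrable_inv_pow_mul_exp_neg_sq_sub_I (k + 2)).const_mul (-(k + 1 : ℂ))
  have h0 := integrable_inv_pow_mul_exp_neg_sq_sub_I k
  have h := integral_eq_zero_of_hasDerivAt_of_integrable
    (f := fun u : ℝ => ((u - I : ℂ) ^ (k + 1))⁻¹ * cexp (-(u - I) ^ 2 / 2)) (fun u => by
      have hu := ofReal_sub_I_ne_zero u
      have h1 : HasDerivAt (fun z : ℂ => ((z - I) ^ (k + 1))⁻¹ * cexp (-(z - I) ^ 2 / 2))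
          (-(k + 1) * (((u - I : ℂ) ^ (k + 2))⁻¹ * cexp (-(u - I) ^ 2 / 2)) -
            ((u - I : ℂ) ^ k)⁻¹ * cexp (-(u - I) ^ 2 / 2)) u := by
        have hs := (hasDerivAt_id' (u : ℂ)).sub_const I
        have ha := (hs.fun_pow (k + 1)).fun_inv (pow_ne_zero _ hu)
        have hb := (((hs.fun_pow 2).fun_neg).div_const 2).cexp
        refine (ha.fun_mul hb).congr_deriv ?_
        rw [Nat.add_sub_cancel]
        push_cast
        field_simp
        ring
      exact h1.comp_ofReal) (h2.sub h0) (integrable_inv_pow_mul_exp_neg_sq_sub_I (k + 1))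
  rw [integral_sub' h2 h0, integral_const_mul] at h
  linear_combination -h

theorem integral_inv_pow_six_mul_exp_neg_sq_sub_I :
    ∫ u : ℝ, ((u - I : ℂ) ^ 6)⁻¹ * cexp (-(u - I) ^ 2 / 2) = -(√(2 * Real.pi) / 15 : ℝ) := by
  have h4 := integral_inv_pow_mul_exp_neg_sq_sub_I_succ 4
  have h2 := integral_inv_pow_mul_exp_neg_sq_sub_I_succ 2
  have h0 := integral_inv_pow_mul_exp_neg_sq_sub_I_succ 0
  simp only [pow_zero, inv_one, one_mul, integral_exp_neg_sq_sub_I] at h0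
  norm_num at h4 h2 h0 ⊢
  linear_combination h4 / 5 - h2 / 15 + h0 / 15

theorem integral_cosh_mul_comp_sinh (g : ℝ → ℝ) :
    ∫ τ : ℝ, Real.cosh τ * g (Real.sinh τ) = ∫ s : ℝ, g s := by
  have h := integral_image_eq_integral_abs_deriv_smul MeasurableSet.univ
    (fun x _ => (Real.hasDerivAt_sinh x).hasDerivWithinAt) Real.sinh_injective.injOn g
  rw [Set.image_univ, Real.sinh_surjective.range_eq] at h
  simpa [abs_of_pos (Real.cosh_pos _)] using h.symm

theorem sin_two_mul_arctan_sub (s θ : ℝ) :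
    Real.sin (2 * Real.arctan s - θ) =
      (2 * s * Real.cos θ - (1 - s ^ 2) * Real.sin θ) / (1 + s ^ 2) := by
  have hs : 0 < 1 + s ^ 2 := by positivity
  have hq : √(1 + s ^ 2) ^ 2 = 1 + s ^ 2 := Real.sq_sqrt hs.le
  have hq0 : √(1 + s ^ 2) ≠ 0 := (Real.sqrt_pos.2 hs).ne'
  rw [Real.sin_sub, Real.sin_two_mul, Real.cos_two_mul, Real.sin_arctan, Real.cos_arctan]
  field_simp
  rw [hq]
  ring

/-- The complexified integrand in the variable `s = sinh τ`, up to the factor `-16`; `L` stands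
for `ε⁻³`. -/
noncomputable def phaseIntegrand (L : ℝ) (s : ℂ) : ℂ :=
  s / ((s - I) ^ 6 * (s + I) ^ 4) * cexp (I * L * (s / 2 + s ^ 3 / 6))

theorem im_phaseIntegrand_ofReal (L s : ℝ) :
    (phaseIntegrand L s).im =
      s / (1 + s ^ 2) ^ 5 * Real.sin (2 * Real.arctan s - L * (s / 2 + s ^ 3 / 6)) := by
  have hs : (1 + s ^ 2 : ℝ) ≠ 0 := by positivity
  have hm : (s - I : ℂ) ≠ 0 := fun h => by simpa using congrArg im h
  have hp : (s + I : ℂ) ≠ 0 := fun h => by simpa using congrArg im h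
  have hmp : (s - I : ℂ) * (s + I) = ((1 + s ^ 2 : ℝ) : ℂ) := by
    push_cast
    linear_combination -I_sq
  have e : phaseIntegrand L s = ((s / (1 + s ^ 2) ^ 6 : ℝ) : ℂ) *
      ((s + I) ^ 2 * cexp ((L * (s / 2 + s ^ 3 / 6) : ℝ) * I)) := by
    have : (s : ℂ) / ((s - I) ^ 6 * (s + I) ^ 4) =
        ((s / (1 + s ^ 2) ^ 6 : ℝ) : ℂ) * (s + I) ^ 2 := by
      rw [ofReal_div, ofReal_pow, ← hmp]
      field_simp
    rw [phaseIntegrand, this, mul_assoc]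
    congr 3
    push_cast
    ring
  rw [e]
  generalize L * (s / 2 + s ^ 3 / 6) = θ
  rw [im_ofReal_mul, exp_mul_I, ← ofReal_cos, ← ofReal_sin, sin_two_mul_arctan_sub]
  simp [pow_two, -ofReal_cos, -ofReal_sin]
  field_simp
  ring

theorem aa_pow_mul_bb_mul_sin_psi (ε τ : ℝ) :
    aa τ ^ 7 * bb τ * Real.sin (psi ε τ) =
      Real.cosh τ * (-16 * (phaseIntegrand (ε ^ 3)⁻¹ (Real.sinh τ : ℝ)).im) := by
  have hc : Real.exp τ + Real.exp (-τ) = 2 * Real.cosh τ := by rw [Real.cosh_eq]; ring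
  have hs : Real.exp τ - Real.exp (-τ) = 2 * Real.sinh τ := by rw [Real.sinh_eq]; ring
  have hs' : Real.exp (-τ) - Real.exp τ = -(2 * Real.sinh τ) := by rw [Real.sinh_eq]; ring
  have hs3 : Real.exp (3 * τ) - Real.exp (-(3 * τ)) =
      2 * (4 * Real.sinh τ ^ 3 + 3 * Real.sinh τ) := by
    rw [← Real.sinh_three_mul, Real.sinh_eq]; ring
  have hψ : psi ε τ = 2 * Real.arctan (Real.sinh τ) -
      (ε ^ 3)⁻¹ * (Real.sinh τ / 2 + Real.sinh τ ^ 3 / 6) := by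
    rw [psi, hs, hs3, mul_div_cancel_left₀ _ two_ne_zero]
    ring
  have hab : aa τ ^ 7 * bb τ =
      Real.cosh τ * (-16 * (Real.sinh τ / (1 + Real.sinh τ ^ 2) ^ 5)) := by
    have h2 : √2 ^ 8 = (16 : ℝ) := by
      rw [show (8 : ℕ) = 2 * 4 from rfl, pow_mul, Real.sq_sqrt zero_le_two]
      norm_num
    have hc0 := (Real.cosh_pos τ).ne'
    rw [aa, bb, hc, hs', add_comm 1, ← Real.cosh_sq]
    field_simp
    linear_combination (-Real.sinh τ) * h2
  rw [hab, hψ, im_phaseIntegrand_ofReal]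
  ring

theorem differentiableAt_phaseIntegrand (L : ℝ) {s : ℂ} (h0 : 0 ≤ s.im) (h1 : s.im < 1) :
    DifferentiableAt ℂ (phaseIntegrand L) s := by
  have hm : s - I ≠ 0 := fun h => by
    have := congrArg im h
    simp at this
    linarith
  have hp : s + I ≠ 0 := fun h => by
    have := congrArg im h
    simp at this
    linarith
  unfold phaseIntegrand
  refine DifferentiableAt.mul (DifferentiableAt.div (by fun_prop) (by fun_prop) ?_) (by fun_prop)
  exact mul_ne_zero (pow_ne_zero _ hm) (pow_ne_zero _ hp)

theorem norm_phaseIntegrand_le {L δ x y : ℝ} (hL : 0 ≤ L) (hδ : 0 < δ) (hy : 0 ≤ y)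
    (hyδ : y ≤ 1 - δ) :
    ‖phaseIntegrand L (x + y * I)‖ ≤ (δ ^ 6)⁻¹ * (1 + x ^ 2)⁻¹ := by
  have hexp : ‖cexp (I * L * ((x + y * I) / 2 + (x + y * I) ^ 3 / 6))‖ ≤ 1 := by
    rw [norm_exp, Real.exp_le_one_iff]
    have e : (I * L * ((x + y * I) / 2 + (x + y * I) ^ 3 / 6) : ℂ).re =
        -(L * (y * (3 - y ^ 2 + 3 * x ^ 2) / 6)) := by
      rw [show (x + y * I : ℂ) = ⟨x, y⟩ by apply Complex.ext <;> simp]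
      simp [pow_succ, -mul_eq_mul_left_iff]
      ring
    rw [e, neg_nonpos]
    have : 0 ≤ 3 - y ^ 2 + 3 * x ^ 2 := by nlinarith
    positivity
  have hp : ‖(x + y * I : ℂ)‖ ≤ ‖(x + y * I + I : ℂ)‖ := by
    rw [← sq_le_sq₀ (norm_nonneg _) (norm_nonneg _), Complex.sq_norm, Complex.sq_norm,
      normSq_apply, normSq_apply]
    simp
    nlinarith
  have hp1 : 1 ≤ ‖(x + y * I + I : ℂ)‖ := by
    refine le_trans ?_ (abs_im_le_norm _)
    simp [abs_of_nonneg (by linarith : 0 ≤ y + 1), hy]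
  have hm : δ ^ 2 * (1 + x ^ 2) ≤ ‖(x + y * I - I : ℂ)‖ ^ 2 := by
    rw [Complex.sq_norm, normSq_apply]
    simp
    nlinarith [mul_nonneg (sub_nonneg.2 hyδ) hδ.le,
      mul_nonneg (sub_nonneg.2 hyδ) (sub_nonneg.2 hyδ),
      mul_nonneg (sq_nonneg x) (by nlinarith : 0 ≤ 1 - δ ^ 2)]
  have hm6 : δ ^ 6 * (1 + x ^ 2) ≤ ‖(x + y * I - I : ℂ)‖ ^ 6 := by
    calc δ ^ 6 * (1 + x ^ 2) ≤ δ ^ 6 * (1 + x ^ 2) ^ 3 := by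
          gcongr
          exact le_self_pow₀ (by nlinarith) (by norm_num)
      _ = (δ ^ 2 * (1 + x ^ 2)) ^ 3 := by ring
      _ ≤ (‖(x + y * I - I : ℂ)‖ ^ 2) ^ 3 := by gcongr
      _ = _ := by ring
  rw [phaseIntegrand, norm_mul, norm_div, norm_mul, norm_pow, norm_pow, ← mul_inv]
  refine (mul_le_of_le_one_right (by positivity) hexp).trans ?_
  rw [div_le_iff₀ (mul_pos ((by positivity : 0 < δ ^ 6 * (1 + x ^ 2)).trans_le hm6)
    (pow_pos (one_pos.trans_le hp1) 4))]
  have h4 : ‖(x + y * I : ℂ)‖ ≤ ‖(x + y * I + I : ℂ)‖ ^ 4 :=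
    hp.trans (le_self_pow₀ hp1 (by norm_num))
  calc ‖(x + y * I : ℂ)‖ ≤ ‖(x + y * I + I : ℂ)‖ ^ 4 := h4
    _ = (δ ^ 6 * (1 + x ^ 2))⁻¹ * (δ ^ 6 * (1 + x ^ 2) * ‖(x + y * I + I : ℂ)‖ ^ 4) := by
      field_simp
    _ ≤ _ := by gcongr

/-- The integrand on the line `Im s = 1 - δ`, rescaled around the saddle point `s = I`. -/
noncomputable def saddleIntegrand (δ u : ℝ) : ℂ :=
  ((u - I : ℂ) ^ 6)⁻¹ * cexp (-(u - I) ^ 2 / 2) *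
    ((δ * (u - I) + I) / (δ * (u - I) + 2 * I) ^ 4 * cexp (I * δ * (u - I) ^ 3 / 6))

theorem phaseIntegrand_eq_saddleIntegrand {δ : ℝ} (hδ : δ ≠ 0) (u : ℝ) :
    phaseIntegrand (δ ^ 2)⁻¹ ((δ * u : ℝ) + (1 - δ : ℝ) * I) =
      ((δ ^ 6)⁻¹ * Real.exp (-1 / (3 * δ ^ 2)) : ℝ) * saddleIntegrand δ u := by
  have hδ' : (δ : ℂ) ≠ 0 := ofReal_ne_zero.2 hδ
  have hs : (((δ * u : ℝ) + (1 - δ : ℝ) * I) : ℂ) = δ * (u - I) + I := by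
    push_cast
    ring
  have hexp : I * ((δ ^ 2)⁻¹ : ℝ) * ((δ * (u - I) + I) / 2 + (δ * (u - I) + I) ^ 3 / 6) =
      ((-1 / (3 * δ ^ 2) : ℝ) : ℂ) + (-(u - I) ^ 2 / 2 + I * δ * (u - I) ^ 3 / 6) := by
    generalize (u - I : ℂ) = w
    have h3 : I ^ 3 = -I := I_pow_three
    have h4 : I ^ 4 = 1 := I_pow_four
    push_cast
    field_simp
    ring_nf
    simp only [h3, h4, I_sq]
    ring
  rw [hs, phaseIntegrand, hexp, Complex.exp_add, Complex.exp_add, saddleIntegrand]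
  push_cast
  rw [add_sub_cancel_right, mul_pow, show (δ * (u - I) + I + I : ℂ) = δ * (u - I) + 2 * I by ring]
  simp only [div_eq_mul_inv, mul_inv]
  ring

theorem integral_phaseIntegrand {δ : ℝ} (hδ : 0 < δ) (hδ1 : δ ≤ 1) :
    Integrable (fun s : ℝ => phaseIntegrand (δ ^ 2)⁻¹ s) ∧
    ∫ s : ℝ, phaseIntegrand (δ ^ 2)⁻¹ s =
      ((δ ^ 5)⁻¹ * Real.exp (-1 / (3 * δ ^ 2)) : ℝ) * ∫ u : ℝ, saddleIntegrand δ u := by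
  have h := integral_eq_integral_add_mul_I_of_differentiableOn_strip
    (f := phaseIntegrand (δ ^ 2)⁻¹) (c := 1 - δ) (K := (δ ^ 6)⁻¹) (by linarith)
    (fun z h0 h1 => differentiableAt_phaseIntegrand _ h0 (by linarith))
    (fun x y h0 h1 => norm_phaseIntegrand_le (by positivity) hδ h0 h1)
  refine ⟨h.1, h.2.trans ?_⟩
  have hscale := Measure.integral_comp_mul_left
    (fun x : ℝ => phaseIntegrand (δ ^ 2)⁻¹ (x + (1 - δ : ℝ) * I)) δ
  simp only [phaseIntegrand_eq_saddleIntegrand hδ.ne', integral_const_mul] at hscale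
  rw [abs_of_pos (inv_pos.2 hδ), real_smul] at hscale
  have hδ' : (δ : ℂ) ≠ 0 := ofReal_ne_zero.2 hδ.ne'
  push_cast at hscale ⊢
  field_simp at hscale ⊢
  linear_combination -hscale

theorem norm_saddleIntegrand_sub_le {δ : ℝ} (hδ : 0 < δ) (hδ1 : δ ≤ 1 / 2) (u : ℝ) :
    ‖saddleIntegrand δ u - ((u - I : ℂ) ^ 6)⁻¹ * cexp (-(u - I) ^ 2 / 2) * (I / 16)‖ ≤
      13 * Real.exp (1 / 2) * δ * Real.exp (-(1 / 4) * u ^ 2) := by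
  generalize hw : (u - I : ℂ) = w
  have hw1 : 1 ≤ ‖w‖ := hw ▸ one_le_norm_ofReal_sub_I u
  obtain ⟨z, hz⟩ : ∃ z : ℂ, z = δ * w := ⟨_, rfl⟩
  have hzn : ‖z‖ = δ * ‖w‖ := by rw [hz, norm_mul, norm_real, Real.norm_of_nonneg hδ.le]
  have hq1 : 1 ≤ ‖z + 2 * I‖ := by
    refine le_trans ?_ (abs_im_le_norm _)
    refine le_trans ?_ (le_abs_self _)
    simp [hz, ← hw]
    linarith
  have hq0 : z + 2 * I ≠ 0 := norm_pos_iff.1 (one_pos.trans_le hq1)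
  have hg : ‖(z + I) / (z + 2 * I) ^ 4‖ ≤ 1 := by
    rw [norm_div, norm_pow, div_le_one (by positivity)]
    refine le_trans ?_ (le_self_pow₀ hq1 (by norm_num))
    rw [← sq_le_sq₀ (norm_nonneg _) (norm_nonneg _), Complex.sq_norm, Complex.sq_norm,
      normSq_apply, normSq_apply]
    simp [hz, ← hw]
    nlinarith
  have hg0 : ‖(z + I) / (z + 2 * I) ^ 4 - I / 16‖ ≤ 12 * ‖z‖ := by
    have e : (z + I) / (z + 2 * I) ^ 4 - I / 16 =
        z * (-16 + 24 * I * z + 8 * z ^ 2 - I * z ^ 3) / (16 * (z + 2 * I) ^ 4) := by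
      have h3 : I ^ 3 = -I := I_pow_three
      have h4 : I ^ 4 = 1 := I_pow_four
      have hexp : (z + 2 * I) ^ 4 =
          z ^ 4 + 8 * I * z ^ 3 - 24 * z ^ 2 - 32 * I * z + 16 := by
        ring_nf
        simp only [h3, h4, I_sq]
        ring
      rw [div_sub_div _ _ (pow_ne_zero 4 hq0) (by norm_num), mul_comm ((z + 2 * I) ^ 4) 16]
      congr 1
      rw [hexp]
      linear_combination (32 * z - 8 * z ^ 3) * I_sq
    have hzq : ‖z‖ ≤ 3 * ‖z + 2 * I‖ := by
      have : ‖z‖ ≤ ‖z + 2 * I‖ + ‖2 * I‖ := by simpa using norm_sub_le (z + 2 * I) (2 * I)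
      simp at this
      linarith
    have hpoly : ‖-16 + 24 * I * z + 8 * z ^ 2 - I * z ^ 3‖ ≤ 187 * ‖z + 2 * I‖ ^ 3 := by
      have h : ‖-16 + 24 * I * z + 8 * z ^ 2 - I * z ^ 3‖ ≤
          16 + 24 * ‖z‖ + 8 * ‖z‖ ^ 2 + ‖z‖ ^ 3 := by
        refine (norm_sub_le _ _).trans (add_le_add ((norm_add_le _ _).trans (add_le_add
          ((norm_add_le _ _).trans (add_le_add ?_ ?_)) ?_)) ?_) <;> simp
      have h2 : ‖z‖ ^ 2 ≤ (3 * ‖z + 2 * I‖) ^ 2 := by gcongr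
      have h3 : ‖z‖ ^ 3 ≤ (3 * ‖z + 2 * I‖) ^ 3 := by gcongr
      have k1 : ‖z + 2 * I‖ ≤ ‖z + 2 * I‖ ^ 3 := le_self_pow₀ hq1 (by norm_num)
      have k2 : ‖z + 2 * I‖ ^ 2 ≤ ‖z + 2 * I‖ ^ 3 := pow_le_pow_right₀ hq1 (by norm_num)
      nlinarith
    rw [e, norm_div, norm_mul, norm_mul, norm_pow,
      div_le_iff₀ (mul_pos (by norm_num) (pow_pos (one_pos.trans_le hq1) 4))]
    have k3 : ‖z + 2 * I‖ ^ 3 ≤ ‖z + 2 * I‖ ^ 4 := pow_le_pow_right₀ hq1 (by norm_num)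
    calc _ ≤ ‖z‖ * (187 * ‖z + 2 * I‖ ^ 4) := by
          gcongr
          linarith
      _ ≤ ‖z‖ * (192 * ‖z + 2 * I‖ ^ 4) := by
          gcongr
          norm_num
      _ = _ := by
          norm_num
          ring
  have hE : ‖cexp (I * δ * w ^ 3 / 6) - 1‖ ≤ δ * ‖w‖ ^ 3 / 6 * Real.exp (1 / 4 * u ^ 2) := by
    have h := norm_exp_sub_one_le_norm_mul_exp (z := I * δ * w ^ 3 / 6)
      (M := 1 / 4 * u ^ 2) (by positivity) (by
        have : (I * δ * w ^ 3 / 6).re = δ * (3 * u ^ 2 - 1) / 6 := by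
          rw [← hw, show (u - I : ℂ) = ⟨u, -1⟩ by apply Complex.ext <;> simp]
          simp [pow_succ]
          ring
        rw [this]
        nlinarith [sq_nonneg u])
    simpa [abs_of_pos hδ] using h
  have hgauss : ‖cexp (-w ^ 2 / 2)‖ = Real.exp (1 / 2) * Real.exp (-(1 / 2) * u ^ 2) := by
    rw [norm_exp, ← Real.exp_add]
    congr 1
    rw [← hw, show (u - I : ℂ) = ⟨u, -1⟩ by apply Complex.ext <;> simp]
    simp [pow_succ]
    ring
  have e : saddleIntegrand δ u - (w ^ 6)⁻¹ * cexp (-w ^ 2 / 2) * (I / 16) =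
      (w ^ 6)⁻¹ * cexp (-w ^ 2 / 2) * ((z + I) / (z + 2 * I) ^ 4 * (cexp (I * δ * w ^ 3 / 6) - 1) +
        ((z + I) / (z + 2 * I) ^ 4 - I / 16)) := by
    rw [saddleIntegrand, hw, ← hz]
    ring
  have hexp1 : 1 ≤ Real.exp (1 / 4 * u ^ 2) := Real.one_le_exp (by positivity)
  have hbr : ‖(z + I) / (z + 2 * I) ^ 4 * (cexp (I * δ * w ^ 3 / 6) - 1) +
      ((z + I) / (z + 2 * I) ^ 4 - I / 16)‖ ≤ 13 * δ * ‖w‖ ^ 6 * Real.exp (1 / 4 * u ^ 2) := by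
    have k1 : ‖w‖ ≤ ‖w‖ ^ 6 := le_self_pow₀ hw1 (by norm_num)
    have k2 : ‖w‖ ^ 3 ≤ ‖w‖ ^ 6 := pow_le_pow_right₀ hw1 (by norm_num)
    have a1 : ‖(z + I) / (z + 2 * I) ^ 4 * (cexp (I * δ * w ^ 3 / 6) - 1)‖ ≤
        δ * ‖w‖ ^ 6 * Real.exp (1 / 4 * u ^ 2) := by
      rw [norm_mul]
      refine (mul_le_of_le_one_left (norm_nonneg _) hg).trans (hE.trans ?_)
      gcongr
      nlinarith [mul_le_mul_of_nonneg_left k2 hδ.le, pow_pos (one_pos.trans_le hw1) 6]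
    have a2 : 12 * ‖z‖ ≤ 12 * δ * ‖w‖ ^ 6 * Real.exp (1 / 4 * u ^ 2) := by
      rw [hzn, ← mul_assoc]
      calc 12 * δ * ‖w‖ ≤ 12 * δ * ‖w‖ ^ 6 := by gcongr
        _ ≤ _ := le_mul_of_one_le_right (by positivity) hexp1
    refine (norm_add_le _ _).trans ?_
    linarith
  rw [e, norm_mul, norm_mul, norm_inv, norm_pow, hgauss]
  calc _ ≤ (‖w‖ ^ 6)⁻¹ * (Real.exp (1 / 2) * Real.exp (-(1 / 2) * u ^ 2)) *
        (13 * δ * ‖w‖ ^ 6 * Real.exp (1 / 4 * u ^ 2)) := by gcongr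
    _ = 13 * Real.exp (1 / 2) * δ * (Real.exp (-(1 / 2) * u ^ 2) * Real.exp (1 / 4 * u ^ 2)) := by
      have : ‖w‖ ≠ 0 := (one_pos.trans_le hw1).ne'
      field_simp
    _ = _ := by
      rw [← Real.exp_add]
      congr 2
      ring

theorem exists_norm_integral_saddleIntegrand_add_le :
    ∃ C > 0, ∀ δ : ℝ, 0 < δ → δ ≤ 1 / 2 →
      ‖(∫ u : ℝ, saddleIntegrand δ u) + I / 16 * (√(2 * Real.pi) / 15 : ℝ)‖ ≤ C * δ := by
  have hb := integrable_exp_neg_mul_sq (b := 1 / 4) (by norm_num)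
  have hpos : 0 ≤ ∫ u : ℝ, Real.exp (-(1 / 4) * u ^ 2) :=
    integral_nonneg fun u => (Real.exp_pos _).le
  refine ⟨13 * Real.exp (1 / 2) * (∫ u : ℝ, Real.exp (-(1 / 4) * u ^ 2)) + 1, by positivity,
    fun δ hδ hδ1 => ?_⟩
  have hbd := hb.const_mul (13 * Real.exp (1 / 2) * δ)
  have hlead := (integrable_inv_pow_mul_exp_neg_sq_sub_I 6).mul_const (I / 16)
  have hle := norm_saddleIntegrand_sub_le hδ hδ1
  have hmeas : AEStronglyMeasurable (saddleIntegrand δ) := by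
    refine Continuous.aestronglyMeasurable ?_
    unfold saddleIntegrand
    refine Continuous.mul (Continuous.mul (Continuous.inv₀ (by fun_prop) fun u =>
      pow_ne_zero _ (ofReal_sub_I_ne_zero u)) (by fun_prop)) (Continuous.mul (Continuous.div
        (by fun_prop) (by fun_prop) fun u => pow_ne_zero _ fun h => ?_) (by fun_prop))
    have := congrArg im h
    simp at this
    linarith
  have hdiff := hbd.mono' (hmeas.sub hlead.aestronglyMeasurable) (.of_forall hle)
  have hsad : Integrable (saddleIntegrand δ) := by simpa using hdiff.add hlead
  have hnorm := norm_integral_le_of_norm_le hbd (.of_forall hle)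
  rw [integral_sub hsad hlead, integral_mul_const, integral_inv_pow_six_mul_exp_neg_sq_sub_I,
    integral_const_mul] at hnorm
  calc _ = _ := by
        congr 1
        ring
    _ ≤ _ := hnorm
    _ ≤ _ := by linarith

/-- `ε⁶ ∫ a⁷ b sin ψ_ε dτ = (2/15) √(π/2) ε^{−3/2} e^{−1/(3ε³)} + O(e^{−1/(3ε³)})`. -/
theorem J_odd_dominant_asymptotics :
    ∃ C > (0 : ℝ), ∃ ε₁ > (0 : ℝ), ∀ ε : ℝ, 0 < ε → ε < ε₁ →
      |ε ^ 6 * (∫ τ : ℝ, (aa τ) ^ 7 * bb τ * Real.sin (psi ε τ))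
          - (2 / 15) * Real.sqrt (Real.pi / 2) * ε ^ (-(3 : ℝ) / 2) *
            Real.exp (-1 / (3 * ε ^ 3))|
        ≤ C * Real.exp (-1 / (3 * ε ^ 3)) := by
  obtain ⟨C, hC, hbound⟩ := exists_norm_integral_saddleIntegrand_add_le
  refine ⟨16 * C, by positivity, 1 / 2, by norm_num, fun ε hε hε1 => ?_⟩
  obtain ⟨δ, hδ, hδε⟩ : ∃ δ : ℝ, 0 < δ ∧ δ ^ 2 = ε ^ 3 :=
    ⟨√(ε ^ 3), by positivity, Real.sq_sqrt (by positivity)⟩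
  have hδ1 : δ ≤ 1 / 2 := by
    have : ε ^ 3 ≤ (1 / 2) ^ 3 := by gcongr
    nlinarith
  have hpow : ε ^ (-(3 : ℝ) / 2) = δ⁻¹ := by
    have h : ε ^ (3 / 2 : ℝ) = δ := by
      rw [← Real.sqrt_sq hδ.le, hδε, Real.sqrt_eq_rpow, ← Real.rpow_natCast, ← Real.rpow_mul hε.le]
      norm_num
    rw [neg_div, Real.rpow_neg hε.le, h]
  have hsqrt : 2 / 15 * √(Real.pi / 2) = √(2 * Real.pi) / 15 := by
    rw [show 2 * Real.pi = 2 ^ 2 * (Real.pi / 2) by ring, Real.sqrt_mul (by norm_num),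
      Real.sqrt_sq (by norm_num)]
    ring
  obtain ⟨hinteg, hval⟩ := integral_phaseIntegrand hδ (by linarith)
  have him : ∫ s : ℝ, (phaseIntegrand (δ ^ 2)⁻¹ s).im =
      (δ ^ 5)⁻¹ * Real.exp (-1 / (3 * δ ^ 2)) * (∫ u : ℝ, saddleIntegrand δ u).im := by
    rw [← im_ofReal_mul, ← hval]
    exact integral_im hinteg
  have hJ : ∫ τ : ℝ, aa τ ^ 7 * bb τ * Real.sin (psi ε τ) =
      -16 * ∫ s : ℝ, (phaseIntegrand (δ ^ 2)⁻¹ s).im := by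
    simp only [aa_pow_mul_bb_mul_sin_psi, ← hδε]
    rw [integral_cosh_mul_comp_sinh (fun s => -16 * (phaseIntegrand (δ ^ 2)⁻¹ s).im),
      integral_const_mul]
  have hε6 : ε ^ 6 = δ ^ 4 := by
    rw [show ε ^ 6 = (ε ^ 3) ^ 2 by ring, ← hδε]
    ring
  rw [hJ, him, hpow, hsqrt, ← hδε, hε6]
  set E := Real.exp (-1 / (3 * δ ^ 2))
  have hfinal : |(∫ u : ℝ, saddleIntegrand δ u).im + √(2 * Real.pi) / 15 / 16| ≤ C * δ := by
    refine le_trans (le_of_eq ?_) ((abs_im_le_norm _).trans (hbound δ hδ hδ1))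
    congr 1
    rw [add_im, im_mul_ofReal]
    norm_num
    ring
  have e : δ ^ 4 * (-16 * ((δ ^ 5)⁻¹ * E * (∫ u : ℝ, saddleIntegrand δ u).im)) -
      √(2 * Real.pi) / 15 * δ⁻¹ * E =
      -(16 * δ⁻¹ * E) * ((∫ u : ℝ, saddleIntegrand δ u).im + √(2 * Real.pi) / 15 / 16) := by
    field_simp
    ring
  have hE : 0 < E := Real.exp_pos _
  rw [e, abs_mul, abs_neg, abs_of_pos (by positivity)]
  calc _ ≤ 16 * δ⁻¹ * E * (C * δ) := by gcongr
    _ = _ := by field_simp
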